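/- If G is a connected bridgeless simple graph with diameter 2, then rc(G) ≤ 5; that is, there exists an edge coloring of G using at most 5 colors under which G is rainbow connected. -/

import Mathlib

/-- A graph `G` with an edge coloring `c` is *rainbow connected* if every pair of distinct
vertices is joined by a path whose edges all receive distinct colors. -/
def RainbowConnected {α β : Type*} (G : SimpleGraph α) (c : Sym2 α → β) : Prop :=
  ∀ x y : α, x ≠ y → ∃ p : G.Walk x y, p.IsPath ∧ (p.edges.map c).Nodup

namespace RC

/-- There is a rainbow walk from `u` to `w` with all colors in `S`. -/
def RP {α : Type*} (G : SimpleGraph α) (col : Sym2 α → Fin 5) (S : Finset (Fin 5)) (u w : α) :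
    Prop :=
  ∃ p : G.Walk u w, (p.edges.map col).Nodup ∧ ∀ k ∈ p.edges.map col, k ∈ S

section rp
variable {α : Type*} {G : SimpleGraph α} {col : Sym2 α → Fin 5} {S T U : Finset (Fin 5)}
  {u w m : α}

theorem RP.nil : RP G col S u u := ⟨SimpleGraph.Walk.nil, by simp, by simp⟩

theorem RP.edge {k : Fin 5} (h : G.Adj u w) (e : col s(u, w) = k) : RP G col {k} u w :=
  ⟨h.toWalk, by simp, by simp [e]⟩

theorem RP.edge' {k : Fin 5} (h : G.Adj u w) (e : col s(w, u) = k) : RP G col {k} u w :=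
  RP.edge h (by rw [Sym2.eq_swap]; exact e)

theorem RP.mono (h : RP G col S u w) (hs : S ⊆ U := by decide) : RP G col U u w := by
  obtain ⟨p, h1, h2⟩ := h
  exact ⟨p, h1, fun k hk => hs (h2 k hk)⟩

theorem RP.trans (h1 : RP G col S u m) (h2 : RP G col T m w) (hd : Disjoint S T := by decide) :
    RP G col (S ∪ T) u w := by
  obtain ⟨p, p1, p2⟩ := h1
  obtain ⟨q, q1, q2⟩ := h2
  refine ⟨p.append q, ?_, ?_⟩
  · rw [SimpleGraph.Walk.edges_append, List.map_append, List.nodup_append]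
    refine ⟨p1, q1, ?_⟩
    intro a ha b hb hab
    subst hab
    exact Finset.disjoint_left.mp hd (p2 a ha) (q2 a hb)
  · intro k hk
    rw [SimpleGraph.Walk.edges_append, List.map_append, List.mem_append] at hk
    rw [Finset.mem_union]
    exact hk.imp (p2 k) (q2 k)

theorem RP.symm (h : RP G col S u w) : RP G col S w u := by
  obtain ⟨p, p1, p2⟩ := h
  refine ⟨p.reverse, ?_, ?_⟩
  · rw [SimpleGraph.Walk.edges_reverse, List.map_reverse, List.nodup_reverse]; exact p1
  · intro k hk
    rw [SimpleGraph.Walk.edges_reverse, List.map_reverse, List.mem_reverse] at hk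
    exact p2 k hk

theorem RP.path (h : RP G col S u w) :
    ∃ p : G.Walk u w, p.IsPath ∧ (p.edges.map col).Nodup := by
  classical
  obtain ⟨p, p1, _⟩ := h
  exact ⟨p.bypass, p.bypass_isPath, p1.sublist (p.edges_bypass_sublist_edges.map col)⟩

theorem RP.comp (f : Fin 5 → Fin 5) (h : RP G (fun e => f (col e)) S u w) 
    (hf : ∀ k, f (f k) = k) : RP G col (S.image f) u w := by
  obtain ⟨p, p1, p2⟩ := h
  have e : p.edges.map (fun e => f (col e)) = (p.edges.map col).map f := by
    rw [List.map_map]; rfl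
  rw [e] at p1 p2
  refine ⟨p, p1.of_map f, ?_⟩
  intro k hk
  rw [Finset.mem_image]
  exact ⟨f k, p2 _ (List.mem_map_of_mem hk), hf k⟩

end rp

section defs
variable {α : Type*} (G : SimpleGraph α) (v : α)

/-- Vertices at distance two from `v`. -/
def InC (u : α) : Prop := u ≠ v ∧ ¬ G.Adj v u

/-- `c` has a neighbour in `Y`. -/
def Has (Y : Set α) (c : α) : Prop := ∃ y ∈ Y, G.Adj c y

/-- `c` is far from `Y`. -/
def Bad (Y : Set α) (c : α) : Prop :=
  InC G v c ∧ ¬ Has G Y c ∧ ∀ c', InC G v c' → G.Adj c c' → ¬ Has G Y c'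

def SingleAt (c a : α) : Prop :=
  G.Adj v a ∧ G.Adj c a ∧ ∀ b, G.Adj v b → G.Adj c b → b = a

def Single (c : α) : Prop := ∃ a, SingleAt G v c a

/-- Any two different vertices are adjacent or have a common neighbour. -/
def D2 : Prop := ∀ u w : α, u ≠ w → G.Adj u w ∨ ∃ m, G.Adj u m ∧ G.Adj m w

/-- `X` and `Y` partition the neighbourhood of `v`. -/
structure Parti (X Y : Set α) : Prop where
  hX : ∀ a ∈ X, G.Adj v a
  hY : ∀ a ∈ Y, G.Adj v a
  cov : ∀ a, G.Adj v a → a ∈ X ∨ a ∈ Y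
  dis : ∀ a ∈ X, a ∉ Y

/-- The properties of the coloring used in the basic case. -/
structure ColB (X Y : Set α) (F : α → α → Prop) (col : Sym2 α → Fin 5) : Prop where
  vx : ∀ a ∈ X, col s(v, a) = 1
  vy : ∀ a ∈ Y, col s(v, a) = 2
  xy : ∀ a ∈ X, ∀ b ∈ Y, col s(a, b) = 3
  xc4 : ∀ a ∈ X, ∀ c, InC G v c → ¬ F a c → col s(a, c) = 4
  xc0 : ∀ a ∈ X, ∀ c, InC G v c → F a c → col s(a, c) = 0
  yc0 : ∀ a ∈ Y, ∀ c, InC G v c → ¬ F a c → col s(a, c) = 0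
  yc4 : ∀ a ∈ Y, ∀ c, InC G v c → F a c → col s(a, c) = 4
  cc : ∀ c c', InC G v c → InC G v c' → Has G X c → Has G Y c' → col s(c, c') = 3

def FB (X Y : Set α) (ch : α → α) (a c : α) : Prop :=
  (Bad G v Y c ∨ Bad G v X c) ∧ ¬ Single G v c ∧ a = ch c

end defs

section basic
variable {α : Type*} {G : SimpleGraph α} {v : α} {X Y : Set α}

theorem Parti.symm (h : Parti G v X Y) : Parti G v Y X :=
  ⟨h.hY, h.hX, fun a ha => (h.cov a ha).symm, fun a ha hx => h.dis a hx ha⟩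

theorem InC.has (hd : D2 G) (hp : Parti G v X Y) {c : α} (hc : InC G v c) :
    Has G X c ∨ Has G Y c := by
  rcases hd v c hc.1.symm with h | ⟨m, h1, h2⟩
  · exact absurd h hc.2
  · rcases hp.cov m h1 with h | h
    · exact Or.inl ⟨m, h, h2.symm⟩
    · exact Or.inr ⟨m, h, h2.symm⟩

theorem cases3 (hp : Parti G v X Y) (u : α) : u = v ∨ u ∈ X ∨ u ∈ Y ∨ InC G v u := by
  by_cases h : u = v
  · exact Or.inl h
  · by_cases h' : G.Adj v u
    · rcases hp.cov u h' with h'' | h''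
      · exact Or.inr (Or.inl h'')
      · exact Or.inr (Or.inr (Or.inl h''))
    · exact Or.inr (Or.inr (Or.inr ⟨h, h'⟩))

theorem Bad.common (hd : D2 G) (hp : Parti G v X Y) {c y : α} (hc : Bad G v Y c) (hy : y ∈ Y) :
    ∃ x ∈ X, G.Adj c x ∧ G.Adj x y := by
  have hne : c ≠ y := by
    rintro rfl
    exact hc.1.2 (hp.hY c hy)
  rcases hd c y hne with h | ⟨m, h1, h2⟩
  · exact absurd ⟨y, hy, h⟩ hc.2.1
  · rcases cases3 hp m with h | h | h | h
    · subst h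
      exact absurd h1.symm hc.1.2
    · exact ⟨m, h, h1, h2⟩
    · exact absurd ⟨m, h, h1⟩ hc.2.1
    · exact absurd ⟨y, hy, h2⟩ (hc.2.2 m h h1)

theorem Bad.complete (hd : D2 G) (hp : Parti G v X Y) {c a y : α} (hc : Bad G v Y c)
    (hs : SingleAt G v c a) (hy : y ∈ Y) : G.Adj a y := by
  obtain ⟨x, hx, h1, h2⟩ := hc.common hd hp hy
  rw [hs.2.2 x (hp.hX x hx) h1] at h2
  exact h2

theorem xside (hd : D2 G) (hp : Parti G v X Y) {ch : α → α} {F : α → α → Prop}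
    {col : Sym2 α → Fin 5} (hF : ∀ a c, F a c ↔ FB G v X Y ch a c) (hcol : ColB G v X Y F col)
    (hne : Y.Nonempty)
    (hadm : ∀ a ∈ X, (∃ y ∈ Y, G.Adj a y) ∨ ∃ c, InC G v c ∧ G.Adj a c)
    (hch : ∀ c, Bad G v Y c → G.Adj c (ch c) ∧ ch c ∈ X ∧ ∃ y ∈ Y, G.Adj (ch c) y) :
    (∀ x ∈ X, RP G col {1} x v ∧ RP G col {0, 2, 3, 4} x v) ∧
    (∀ c, InC G v c → Has G X c → RP G col {1, 4} c v ∧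
      (RP G col {0, 2, 3} c v ∨ (Bad G v Y c ∧ Single G v c ∧ RP G col {2, 3, 4} c v))) := by
  have xv : ∀ x ∈ X, RP G col {1} x v := fun x hx => RP.edge' (hp.hX x hx).symm (hcol.vx x hx)
  have yv : ∀ y ∈ Y, RP G col {2} y v := fun y hy => RP.edge' (hp.hY y hy).symm (hcol.vy y hy)
  have xyv : ∀ x ∈ X, ∀ y ∈ Y, G.Adj x y → RP G col {3, 2} x v := fun x hx y hy h =>
    ((RP.edge h (hcol.xy x hx y hy)).trans (yv y hy)).mono
  -- a vertex having both kinds of neighbours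
  have hxy : ∀ c, InC G v c → Has G X c → Has G Y c → RP G col {0, 2} c v := by
    intro c hc h1 ⟨y, hy, h2⟩
    have : ¬ F y c := by
      rw [hF]
      rintro ⟨hb | hb, _⟩
      · exact hb.2.1 ⟨y, hy, h2⟩
      · exact hb.2.1 h1
    exact ((RP.edge' h2 (hcol.yc0 y hy c hc this)).trans (yv y hy)).mono
  -- good vertices
  have hgood : ∀ c, InC G v c → Has G X c → ¬ Bad G v Y c → RP G col {0, 2, 3} c v := by
    intro c hc h1 h2
    by_cases h3 : Has G Y c
    · exact (hxy c hc h1 h3).mono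
    · have : ∃ c', InC G v c' ∧ G.Adj c c' ∧ Has G Y c' := by
        by_contra hcon
        exact h2 ⟨hc, h3, fun c' a b d => hcon ⟨c', a, b, d⟩⟩
      obtain ⟨c', h4, h5, y, hy, h6⟩ := this
      have : ¬ F y c' := by
        rw [hF]
        rintro ⟨hb | hb, _⟩
        · exact hb.2.1 ⟨y, hy, h6⟩
        · exact hb.2.2 c hc h5.symm h1
      exact (((RP.edge h5 (hcol.cc c c' hc h4 h1 ⟨y, hy, h6⟩)).trans
        (RP.edge' h6 (hcol.yc0 y hy c' h4 this))).trans (yv y hy)).mono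
  have hmul : ∀ c, Bad G v Y c → ¬ Single G v c →
      RP G col {0} c (ch c) ∧ RP G col {3, 2} (ch c) v := by
    intro c hb hs
    obtain ⟨h1, h2, y, hy, h3⟩ := hch c hb
    exact ⟨RP.edge' h1 (hcol.xc0 _ h2 c hb.1 ((hF _ _).2 ⟨Or.inl hb, hs, rfl⟩)),
      xyv _ h2 y hy h3⟩
  refine ⟨fun x hx => ⟨xv x hx, ?_⟩, fun c hc h1 => ⟨?_, ?_⟩⟩
  · rcases hadm x hx with ⟨y, hy, h⟩ | ⟨c, hc, h⟩
    · exact (xyv x hx y hy h).mono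
    · have hcX : Has G X c := ⟨x, hx, h.symm⟩
      have nbx : ¬ Bad G v X c := fun hb => hb.2.1 hcX
      by_cases hb : Bad G v Y c
      · by_cases hs : Single G v c
        · obtain ⟨a, ha⟩ := hs
          obtain ⟨y, hy⟩ := hne
          have := hb.complete hd hp ha hy
          rw [← ha.2.2 x (hp.hX x hx) h.symm] at this
          exact (xyv x hx y hy this).mono
        · obtain ⟨h2, h3⟩ := hmul c hb hs
          by_cases hxc : x = ch c
          · rw [hxc]; exact h3.mono
          · have : ¬ F x c := by
              rw [hF]; exact fun h' => hxc h'.2.2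
            exact (((RP.edge h (hcol.xc4 x hx c hc this)).trans h2).trans h3).mono
      · have : ¬ F x c := by
          rw [hF]
          rintro ⟨h' | h', _⟩
          · exact hb h'
          · exact nbx h'
        exact ((RP.edge h (hcol.xc4 x hx c hc this)).trans (hgood c hc hcX hb)).mono
  · have nbx : ¬ Bad G v X c := fun hb => hb.2.1 h1
    have : ∃ x ∈ X, G.Adj c x ∧ ¬ F x c := by
      by_cases hb : Bad G v Y c
      · by_cases hs : Single G v c
        · obtain ⟨x, hx, h⟩ := h1
          exact ⟨x, hx, h, fun hf => ((hF _ _).1 hf).2.1 hs⟩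
        · obtain ⟨h2, h3, _⟩ := hch c hb
          by_contra hcon
          refine hs ⟨ch c, hp.hX _ h3, h2, fun b hb1 hb2 => ?_⟩
          by_contra hbc
          rcases hp.cov b hb1 with h | h
          · exact hcon ⟨b, h, hb2, fun hf => hbc ((hF _ _).1 hf).2.2⟩
          · exact hb.2.1 ⟨b, h, hb2⟩
      · obtain ⟨x, hx, h⟩ := h1
        refine ⟨x, hx, h, fun hf => ?_⟩
        rcases ((hF _ _).1 hf).1 with h' | h'
        · exact hb h'
        · exact nbx h'
    obtain ⟨x, hx, h, hf⟩ := this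
    exact ((RP.edge' h (hcol.xc4 x hx c hc hf)).trans (xv x hx)).mono
  · by_cases hb : Bad G v Y c
    · by_cases hs : Single G v c
      · right
        refine ⟨hb, hs, ?_⟩
        have hf : ∀ a, ¬ F a c := fun a hf => ((hF _ _).1 hf).2.1 hs
        obtain ⟨y, hy⟩ := hne
        obtain ⟨x, hx, h2, h3⟩ := hb.common hd hp hy
        exact ((RP.edge' h2 (hcol.xc4 x hx c hc (hf x))).trans (xyv x hx y hy h3)).mono
      · left
        obtain ⟨h2, h3⟩ := hmul c hb hs
        exact (h2.trans h3).mono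
    · exact Or.inl (hgood c hc h1 hb)

end basic

section coloring
open Classical in
/-- The kind of a vertex: center, `X`, `Y` or other. -/
noncomputable def kind {α : Type*} (v : α) (X Y : Set α) (u : α) : ℕ :=
  if u = v then 0 else if u ∈ X then 1 else if u ∈ Y then 2 else 3

open Classical in
/-- Color of an edge whose first end has the smaller kind. -/
noncomputable def colG {α : Type*} (v : α) (X Y : Set α) (F : α → α → Prop)
    (Q : α → Prop) (a b : α) : Fin 5 :=
  if a = v then (if b ∈ X then (if Q b then 3 else 1) else 2)
  else if a ∈ X then (if b ∈ Y then (if Q a then 1 else 3) else (if F a b then 0 else 4))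
  else (if F a b then 4 else 0)

open Classical in
/-- The coloring. -/
noncomputable def colr {α : Type*} (G : SimpleGraph α) (v : α) (X Y : Set α) (F : α → α → Prop)
    (Q : α → Prop) : Sym2 α → Fin 5 :=
  Sym2.lift ⟨fun a b =>
    if kind v X Y a < kind v X Y b then colG v X Y F Q a b
    else if kind v X Y b < kind v X Y a then colG v X Y F Q b a
    else if kind v X Y a = 1 then 1
    else if Has G Y a ∨ Has G Y b then 3 else 2, by
      intro a b
      rcases lt_trichotomy (kind v X Y a) (kind v X Y b) with h | h | h
      · simp [h, not_lt.mpr h.le]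
      · simp [h, or_comm]
      · simp [h, not_lt.mpr h.le]⟩

variable {α : Type*} {G : SimpleGraph α} {v : α} {X Y : Set α} {F : α → α → Prop} {Q : α → Prop}

theorem kind_v : kind v X Y v = 0 := by simp [kind]

theorem Parti.ne (hp : Parti G v X Y) {a : α} (ha : a ∈ X) : a ≠ v := by
  rintro rfl
  exact (hp.hX a ha).ne rfl

theorem kind_X (hp : Parti G v X Y) {a : α} (ha : a ∈ X) : kind v X Y a = 1 := by
  simp [kind, hp.ne ha, ha]

theorem kind_Y (hp : Parti G v X Y) {a : α} (ha : a ∈ Y) : kind v X Y a = 2 := by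
  have : a ∉ X := fun h => hp.dis a h ha
  simp [kind, hp.symm.ne ha, ha, this]

theorem InC.notX (hp : Parti G v X Y) {a : α} (ha : InC G v a) : a ∉ X :=
  fun h => ha.2 (hp.hX a h)

theorem InC.notY (hp : Parti G v X Y) {a : α} (ha : InC G v a) : a ∉ Y :=
  fun h => ha.2 (hp.hY a h)

theorem kind_C (hp : Parti G v X Y) {a : α} (ha : InC G v a) : kind v X Y a = 3 := by
  simp [kind, ha.1, ha.notX hp, ha.notY hp]

theorem col_vx (hp : Parti G v X Y) {a : α} (ha : a ∈ X) (hq : ¬ Q a) :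
    colr G v X Y F Q s(v, a) = 1 := by
  simp [colr, kind_v, kind_X hp ha, colG, ha, hq]

theorem col_vxQ (hp : Parti G v X Y) {a : α} (ha : a ∈ X) (hq : Q a) :
    colr G v X Y F Q s(v, a) = 3 := by
  simp [colr, kind_v, kind_X hp ha, colG, ha, hq]

theorem col_vy (hp : Parti G v X Y) {a : α} (ha : a ∈ Y) :
    colr G v X Y F Q s(v, a) = 2 := by
  have : a ∉ X := fun h => hp.dis a h ha
  simp [colr, kind_v, kind_Y hp ha, colG, this]

theorem col_xy (hp : Parti G v X Y) {a b : α} (ha : a ∈ X) (hb : b ∈ Y) (hq : ¬ Q a) :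
    colr G v X Y F Q s(a, b) = 3 := by
  simp [colr, kind_X hp ha, kind_Y hp hb, colG, ha, hq, hb, hp.ne ha]

theorem col_xyQ (hp : Parti G v X Y) {a b : α} (ha : a ∈ X) (hb : b ∈ Y) (hq : Q a) :
    colr G v X Y F Q s(a, b) = 1 := by
  simp [colr, kind_X hp ha, kind_Y hp hb, colG, ha, hq, hb, hp.ne ha]

theorem col_xx (hp : Parti G v X Y) {a b : α} (ha : a ∈ X) (hb : b ∈ X) :
    colr G v X Y F Q s(a, b) = 1 := by
  simp [colr, kind_X hp ha, kind_X hp hb]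

theorem col_xc4 (hp : Parti G v X Y) {a c : α} (ha : a ∈ X) (hc : InC G v c) (hF : ¬ F a c) :
    colr G v X Y F Q s(a, c) = 4 := by
  simp [colr, kind_X hp ha, kind_C hp hc, colG, ha, hF, hp.ne ha, hc.notY hp]

theorem col_xc0 (hp : Parti G v X Y) {a c : α} (ha : a ∈ X) (hc : InC G v c) (hF : F a c) :
    colr G v X Y F Q s(a, c) = 0 := by
  simp [colr, kind_X hp ha, kind_C hp hc, colG, ha, hF, hp.ne ha, hc.notY hp]

theorem col_yc0 (hp : Parti G v X Y) {a c : α} (ha : a ∈ Y) (hc : InC G v c) (hF : ¬ F a c) :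
    colr G v X Y F Q s(a, c) = 0 := by
  have : a ∉ X := fun h => hp.dis a h ha
  simp [colr, kind_Y hp ha, kind_C hp hc, colG, this, hF, hp.symm.ne ha]

theorem col_yc4 (hp : Parti G v X Y) {a c : α} (ha : a ∈ Y) (hc : InC G v c) (hF : F a c) :
    colr G v X Y F Q s(a, c) = 4 := by
  have : a ∉ X := fun h => hp.dis a h ha
  simp [colr, kind_Y hp ha, kind_C hp hc, colG, this, hF, hp.symm.ne ha]

theorem col_cc3 (hp : Parti G v X Y) {c c' : α} (hc : InC G v c) (hc' : InC G v c')
    (h : Has G Y c') : colr G v X Y F Q s(c, c') = 3 := by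
  simp [colr, kind_C hp hc, kind_C hp hc', h]

theorem col_cc2 (hp : Parti G v X Y) {c c' : α} (hc : InC G v c) (hc' : InC G v c')
    (h : ¬ Has G Y c) (h' : ¬ Has G Y c') : colr G v X Y F Q s(c, c') = 2 := by
  simp [colr, kind_C hp hc, kind_C hp hc', h, h']

theorem colB_colr (hp : Parti G v X Y) :
    ColB G v X Y F (colr G v X Y F (fun _ => False)) where
  vx _ ha := col_vx hp ha id
  vy _ ha := col_vy hp ha
  xy _ ha _ hb := col_xy hp ha hb id
  xc4 _ ha _ hc hF := col_xc4 hp ha hc hF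
  xc0 _ ha _ hc hF := col_xc0 hp ha hc hF
  yc0 _ ha _ hc hF := col_yc0 hp ha hc hF
  yc4 _ ha _ hc hF := col_yc4 hp ha hc hF
  cc _ _ hc hc' _ h := col_cc3 hp hc hc' h

def sw (k : Fin 5) : Fin 5 := ![4, 2, 1, 3, 0] k

theorem sw_sw : ∀ k, sw (sw k) = k := by decide

theorem ColB.swap {col : Sym2 α → Fin 5} (h : ColB G v X Y F col) :
    ColB G v Y X F (fun e => sw (col e)) where
  vx a ha := by simp only [h.vy a ha]; rfl
  vy a ha := by simp only [h.vx a ha]; rfl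
  xy a ha b hb := by rw [Sym2.eq_swap]; simp only [h.xy b hb a ha]; rfl
  xc4 a ha c hc hF := by simp only [h.yc0 a ha c hc hF]; rfl
  xc0 a ha c hc hF := by simp only [h.yc4 a ha c hc hF]; rfl
  yc0 a ha c hc hF := by simp only [h.xc4 a ha c hc hF]; rfl
  yc4 a ha c hc hF := by simp only [h.xc0 a ha c hc hF]; rfl
  cc c c' hc hc' h1 h2 := by rw [Sym2.eq_swap]; simp only [h.cc c' c hc' hc h2 h1]; rfl

def TX (G : SimpleGraph α) (v : α) (col : Sym2 α → Fin 5) (B : α → Prop) (u : α) : Prop :=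
  RP G col {1, 4} u v ∧ (RP G col {0, 2, 3} u v ∨
    (RP G col {1} u v ∧ RP G col {0, 2, 3, 4} u v) ∨ (B u ∧ RP G col {2, 3, 4} u v))

theorem TX.pair {col : Sym2 α → Fin 5} {B : α → Prop} (hB : ∀ u w, B u → B w → u = w)
    {u w : α} (hu : TX G v col B u) (hw : TX G v col B w) : RP G col Finset.univ u w := by
  obtain ⟨u1, u2⟩ := hu
  obtain ⟨w1, w2⟩ := hw
  rcases u2 with u2 | u2
  · exact (u2.trans w1.symm).mono
  rcases w2 with w2 | w2
  · exact (u1.trans w2.symm).mono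
  rcases u2 with ⟨u3, u4⟩ | ⟨u3, u4⟩ <;> rcases w2 with ⟨w3, w4⟩ | ⟨w3, w4⟩
  · exact (u3.trans w4.symm).mono
  · exact (u3.trans w4.symm).mono
  · exact (u4.trans w3.symm).mono
  · rw [hB u w u3 w3]; exact RP.nil

theorem basic (hd : D2 G) (hp : Parti G v X Y) (hX : X.Nonempty) (hY : Y.Nonempty)
    (hadX : ∀ a ∈ X, (∃ y ∈ Y, G.Adj a y) ∨ ∃ c, InC G v c ∧ G.Adj a c)
    (hadY : ∀ a ∈ Y, (∃ y ∈ X, G.Adj a y) ∨ ∃ c, InC G v c ∧ G.Adj a c)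
    (hBX : ∀ c c', Bad G v Y c ∧ Single G v c → Bad G v Y c' ∧ Single G v c' → c = c')
    (hBY : ∀ c c', Bad G v X c ∧ Single G v c → Bad G v X c' ∧ Single G v c' → c = c') :
    ∃ col : Sym2 α → Fin 5, RainbowConnected G col := by
  have ex : ∀ c, ∃ x, (Bad G v Y c → G.Adj c x ∧ x ∈ X ∧ ∃ y ∈ Y, G.Adj x y) ∧
      (Bad G v X c → G.Adj c x ∧ x ∈ Y ∧ ∃ y ∈ X, G.Adj x y) := by
    intro c
    by_cases h1 : Bad G v Y c
    · obtain ⟨y, hy⟩ := hY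
      obtain ⟨x, hx, h2, h3⟩ := h1.common hd hp hy
      exact ⟨x, fun _ => ⟨h2, hx, y, hy, h3⟩, fun h => absurd ⟨x, hx, h2⟩ h.2.1⟩
    · by_cases h1' : Bad G v X c
      · obtain ⟨y, hy⟩ := hX
        obtain ⟨x, hx, h2, h3⟩ := h1'.common hd hp.symm hy
        exact ⟨x, fun h => absurd h h1, fun _ => ⟨h2, hx, y, hy, h3⟩⟩
      · exact ⟨c, fun h => absurd h h1, fun h => absurd h h1'⟩
  choose ch hch using ex
  have hcol := colB_colr (F := FB G v X Y ch) hp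
  set col := colr G v X Y (FB G v X Y ch) (fun _ => False)
  have sX := xside hd hp (fun _ _ => Iff.rfl) hcol hY hadX (fun c => (hch c).1)
  have sY := xside (F := FB G v X Y ch) hd hp.symm
    (fun a c => by unfold FB; rw [or_comm]) hcol.swap hX hadY (fun c => (hch c).2)
  have ty : ∀ u, u = v ∨ TX G v col (fun c => Bad G v Y c ∧ Single G v c) u ∨
      TX G v (fun e => sw (col e)) (fun c => Bad G v X c ∧ Single G v c) u := by
    intro u
    rcases cases3 hp u with h | h | h | h
    · exact Or.inl h
    · obtain ⟨h1, h2⟩ := sX.1 u h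
      exact Or.inr (Or.inl ⟨h1.mono, Or.inr (Or.inl ⟨h1, h2⟩)⟩)
    · obtain ⟨h1, h2⟩ := sY.1 u h
      exact Or.inr (Or.inr ⟨h1.mono, Or.inr (Or.inl ⟨h1, h2⟩)⟩)
    · rcases h.has hd hp with h' | h'
      · obtain ⟨h1, h2⟩ := sX.2 u h h'
        exact Or.inr (Or.inl ⟨h1, h2.imp id fun h3 => Or.inr ⟨⟨h3.1, h3.2.1⟩, h3.2.2⟩⟩)
      · obtain ⟨h1, h2⟩ := sY.2 u h h'
        exact Or.inr (Or.inr ⟨h1, h2.imp id fun h3 => Or.inr ⟨⟨h3.1, h3.2.1⟩, h3.2.2⟩⟩)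
  refine ⟨col, fun u w _ => ?_⟩
  rcases ty u with rfl | hu | hu <;> rcases ty w with rfl | hw | hw
  · exact (RP.nil (S := ∅)).path
  · exact hw.1.symm.path
  · exact (hw.1.symm.comp sw sw_sw).path
  · exact hu.1.path
  · exact (hu.pair hBX hw).path
  · exact (hu.1.trans (hw.1.comp sw sw_sw).symm).path
  · exact (hu.1.comp sw sw_sw).path
  · exact ((hu.1.comp sw sw_sw).trans hw.1.symm).path
  · exact ((hu.pair hBY hw).comp sw sw_sw).path

end coloring

section stuck
variable {α : Type*} {G : SimpleGraph α} {v : α} {X Y : Set α}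

theorem Bad.memX (hp : Parti G v X Y) {c a : α} (hc : Bad G v Y c) (hv : G.Adj v a)
    (ha : G.Adj c a) : a ∈ X :=
  (hp.cov a hv).resolve_right fun h => hc.2.1 ⟨a, h, ha⟩

theorem SingleAt.notHas (hp : Parti G v X Y) {c a : α} (hs : SingleAt G v c a) (ha : a ∈ X) :
    ¬ Has G Y c := by
  rintro ⟨y, hy, h⟩
  rw [hs.2.2 y (hp.hY y hy) h] at hy
  exact hp.dis a ha hy

theorem core (hd : D2 G) (hp : Parti G v X Y) {x c0 a0 : α} (hx : x ∈ X) (Five : α → Prop)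
    (hXY : ∀ a ∈ X, ∃ y ∈ Y, G.Adj a y) (hYX : ∀ y ∈ Y, ∃ a ∈ X, G.Adj y a)
    (h0 : Bad G v Y c0) (h0s : SingleAt G v c0 a0) (h0x : a0 ≠ x)
    (hF1 : ∀ e, Five e → InC G v e ∧ SingleAt G v e x)
    (hD : ∀ c, Bad G v Y c → Single G v c → ¬ Five c → ∃ e, Five e ∧ G.Adj c e)
    (hF2 : ∀ e, Five e → (∃ c, Bad G v Y c ∧ Single G v c ∧ ¬ Five c ∧ G.Adj e c) ∨
      (Bad G v Y e ∧ ∀ a ∈ X, a ≠ x → G.Adj x a))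
    (hR : ∀ c, Bad G v Y c → SingleAt G v c x →
      ∃ c', InC G v c' ∧ G.Adj c c' ∧ ∃ b, G.Adj v b ∧ b ≠ x ∧ G.Adj c' b) :
    ∃ col : Sym2 α → Fin 5, RainbowConnected G col := by
  have ex : ∀ c, ∃ a, InC G v c → G.Adj v a ∧ G.Adj c a ∧ (G.Adj c x → a = x) := by
    intro c
    by_cases hc : G.Adj c x
    · exact ⟨x, fun _ => ⟨hp.hX x hx, hc, fun _ => rfl⟩⟩
    · by_cases h : InC G v c
      · rcases h.has hd hp with ⟨y, hy, h'⟩ | ⟨y, hy, h'⟩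
        · exact ⟨y, fun _ => ⟨hp.hX y hy, h', fun h => absurd h hc⟩⟩
        · exact ⟨y, fun _ => ⟨hp.hY y hy, h', fun h => absurd h hc⟩⟩
      · exact ⟨c, fun h' => absurd h' h⟩
  choose ch hch using ex
  let Q : α → Prop := fun a => a ≠ x ∧ ∃ c, Bad G v Y c ∧ SingleAt G v c a
  let F : α → α → Prop := fun a c => (Five c ∨ (¬ Single G v c ∧ ¬ Has G Y c)) ∧ a = ch c
  have nQx : ¬ Q x := fun h => h.1 rfl
  set col := colr G v X Y F Q
  have qy : ∀ a, Q a → ∀ y ∈ Y, G.Adj a y := fun a ⟨_, c, h1, h2⟩ y hy =>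
    h1.complete hd hp h2 hy
  have xv : ∀ a ∈ X, (RP G col {1} a v ∧ RP G col {2, 3} a v) ∨
      (RP G col {3} a v ∧ RP G col {1, 2} a v) := by
    intro a ha
    obtain ⟨y, hy, h⟩ := hXY a ha
    have yv : RP G col {2} y v := RP.edge' (hp.hY y hy).symm (col_vy hp hy)
    by_cases hq : Q a
    · exact Or.inr ⟨RP.edge' (hp.hX a ha).symm (col_vxQ hp ha hq),
        ((RP.edge h (col_xyQ hp ha hy hq)).trans yv).mono⟩
    · exact Or.inl ⟨RP.edge' (hp.hX a ha).symm (col_vx hp ha hq),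
        ((RP.edge h (col_xy hp ha hy hq)).trans yv).mono⟩
  have xv' : ∀ a ∈ X, RP G col {1, 3} a v := fun a ha => by
    rcases xv a ha with h | h
    · exact h.1.mono
    · exact h.1.mono
  have yv : ∀ y ∈ Y, RP G col {2} y v := fun y hy =>
    RP.edge' (hp.hY y hy).symm (col_vy hp hy)
  have yv' : ∀ y ∈ Y, RP G col {1, 3} y v := by
    intro y hy
    obtain ⟨a, ha, h⟩ := hYX y hy
    by_cases hq : Q a
    · exact ((RP.edge' h (col_xyQ hp ha hy hq)).trans
        (RP.edge' (hp.hX a ha).symm (col_vxQ hp ha hq))).mono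
    · exact ((RP.edge' h (col_xy hp ha hy hq)).trans
        (RP.edge' (hp.hX a ha).symm (col_vx hp ha hq))).mono
  have AA : ∀ a b, G.Adj v a → G.Adj v b → RP G col {1, 2, 3} a b := by
    intro a b ha hb
    rcases hp.cov a ha with ha | ha <;> rcases hp.cov b hb with hb | hb
    · rcases xv a ha with ⟨h1, h2⟩ | ⟨h1, h2⟩ <;> rcases xv b hb with ⟨h3, h4⟩ | ⟨h3, h4⟩
      · exact (h1.trans h4.symm).mono
      · exact (h1.trans h3.symm).mono
      · exact (h1.trans h3.symm).mono
      · exact (h1.trans h4.symm).mono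
    · exact ((xv' a ha).trans (yv b hb).symm).mono
    · exact ((yv a ha).trans (xv' b hb).symm).mono
    · exact ((yv' a ha).trans (yv b hb).symm).mono
  have Av : ∀ a, G.Adj v a → RP G col {1, 2, 3} a v := by
    intro a ha
    rcases hp.cov a ha with ha | ha
    · exact (xv' a ha).mono
    · exact (yv a ha).mono
  have xy2 : ∀ a ∈ X, ∀ y ∈ Y, RP G col {1, 2} a y := by
    intro a ha y hy
    by_cases hq : Q a
    · exact (RP.edge (qy a hq y hy) (col_xyQ hp ha hy hq)).mono
    · exact ((RP.edge' (hp.hX a ha).symm (col_vx hp ha hq)).trans (yv y hy).symm).mono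
  -- neighbours of bad singles
  have ax : ∀ c a, Bad G v Y c → SingleAt G v c a → RP G col {1, 3} a x := by
    intro c a hc hs
    by_cases hax : a = x
    · rw [hax]; exact RP.nil
    · have hq : Q a := ⟨hax, c, hc, hs⟩
      obtain ⟨y, hy, h⟩ := hXY x hx
      exact ((RP.edge (qy a hq y hy) (col_xyQ hp (hc.memX hp hs.1 hs.2.1) hy hq)).trans
        (RP.edge' h.symm (col_xy hp hx hy nQx))).mono
  have ay : ∀ c a, Bad G v Y c → SingleAt G v c a → ∀ y ∈ Y, RP G col {1, 3} a y := by
    intro c a hc hs y hy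
    have haX := hc.memX hp hs.1 hs.2.1
    have hadj := hc.complete hd hp hs hy
    by_cases hq : Q a
    · exact (RP.edge hadj (col_xyQ hp haX hy hq)).mono
    · exact (RP.edge hadj (col_xy hp haX hy hq)).mono
  -- bad single vertices which are not in `Five`
  have d4 : ∀ c a, a ∈ X → InC G v c → SingleAt G v c a → ¬ Five c → RP G col {4} c a := by
    intro c a ha hc hs hf
    refine RP.edge' hs.2.1 (col_xc4 hp ha hc ?_)
    rintro ⟨h | h, _⟩
    · exact hf h
    · exact h.1 ⟨a, hs⟩
  have five0 : ∀ e, Five e → RP G col {0} e x := by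
    intro e he
    obtain ⟨h1, h2⟩ := hF1 e he
    exact RP.edge' h2.2.1 (col_xc0 hp hx h1 ⟨Or.inl he, ((hch e h1).2.2 h2.2.1).symm⟩)
  have fiveY : ∀ e, Five e → ¬ Has G Y e := fun e he => (hF1 e he).2.notHas hp hx
  have fiveX : ∀ e, Five e → Has G X e := fun e he => ⟨x, hx, (hF1 e he).2.2.1⟩
  -- connection of bad vertices to vertices only adjacent to `Y`
  have badCY : ∀ c d, Bad G v Y c → InC G v d → ¬ Has G X d → RP G col {2, 3} c d := by
    intro c d hc hdd hX
    have hdY : Has G Y d := (hdd.has hd hp).resolve_left hX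
    have hne : c ≠ d := by
      rintro rfl
      exact hc.2.1 hdY
    rcases hd c d hne with h | ⟨m, h1, h2⟩
    · exact absurd hdY (hc.2.2 d hdd h)
    · rcases cases3 hp m with h | h | h | h
      · subst h
        exact absurd h1.symm hc.1.2
      · exact absurd ⟨m, h, h2.symm⟩ hX
      · exact absurd ⟨m, h, h1⟩ hc.2.1
      · exact ((RP.edge h1 (col_cc2 hp hc.1 h hc.2.1 (hc.2.2 m h h1))).trans
          (RP.edge h2 (col_cc3 hp h hdd hdY))).mono
  have hcY0 : ∀ d y, InC G v d → y ∈ Y → G.Adj d y → RP G col {0} d y := by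
    intro d y hdd hy h
    refine RP.edge' h (col_yc0 hp hy hdd ?_)
    rintro ⟨h' | h', _⟩
    · exact fiveY d h' ⟨y, hy, h⟩
    · exact h'.2 ⟨y, hy, h⟩
  have f0 : ¬ Five c0 := fun h => h0x ((hF1 c0 h).2.2.2 a0 h0s.1 h0s.2.1)
  have ha0X := h0.memX hp h0s.1 h0s.2.1
  have hq0 : Q a0 := ⟨h0x, c0, h0, h0s⟩
  -- the second way of vertices in `Five`
  have fivex : ∀ e, Five e → RP G col {1, 2, 3, 4} e x := by
    intro e he
    rcases hF2 e he with ⟨c, hc, ⟨a, hs⟩, hf, h⟩ | ⟨hb, hall⟩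
    · exact (((RP.edge h (col_cc2 hp (hF1 e he).1 hc.1 (fiveY e he) hc.2.1)).trans
        (d4 c a (hc.memX hp hs.1 hs.2.1) hc.1 hs hf)).trans (ax c a hc hs)).mono
    · obtain ⟨c', hc', h1, b, hvb, hbx, h2⟩ := hR e hb (hF1 e he).2
      have hY' := hb.2.2 c' hc' h1
      have : ∃ b, b ∈ X ∧ b ≠ x ∧ G.Adj c' b ∧ ¬ F b c' := by
        have hbX : b ∈ X := (hp.cov b hvb).resolve_right fun h => hY' ⟨b, h, h2⟩
        by_cases hF : F b c'
        · rcases hF with ⟨hF | hF, hbc⟩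
          · exact absurd ((hF1 c' hF).2.2.2 b hvb h2) hbx
          · have hc'x : ¬ G.Adj c' x := fun h => hbx (hbc.trans ((hch c' hc').2.2 h))
            by_contra hcon
            refine hF.1 ⟨b, hvb, h2, fun b' h3 h4 => ?_⟩
            by_contra hbb
            refine hcon ⟨b', (hp.cov b' h3).resolve_right fun h => hY' ⟨b', h, h4⟩, ?_, h4, ?_⟩
            · rintro rfl
              exact hc'x h4
            · rintro ⟨_, h5⟩
              exact hbb (h5.trans hbc.symm)
        · exact ⟨b, hbX, hbx, h2, hF⟩
      obtain ⟨b, hbX, hbx, h2, hF⟩ := this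
      exact (((RP.edge h1 (col_cc2 hp hb.1 hc' hb.2.1 hY')).trans
        (RP.edge' h2 (col_xc4 hp hbX hc' hF))).trans
        (RP.edge (hall b hbX hbx).symm (col_xx hp hbX hx))).mono
  have fiveCY : ∀ e d, Five e → InC G v d → ¬ Has G X d → RP G col Finset.univ e d := by
    intro e d he hdd hX
    rcases hF2 e he with ⟨c, hc, ⟨a, hs⟩, hf, h⟩ | ⟨hb, _⟩
    · obtain ⟨y, hy, h'⟩ := (hdd.has hd hp).resolve_left hX
      exact ((((RP.edge h (col_cc2 hp (hF1 e he).1 hc.1 (fiveY e he) hc.2.1)).trans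
        (d4 c a (hc.memX hp hs.1 hs.2.1) hc.1 hs hf)).trans (ay c a hc hs y hy)).trans
        (hcY0 d y hdd hy h').symm).mono
    · exact (badCY e d hb hdd hX).mono
  have CYCY : ∀ d d', InC G v d → InC G v d' → ¬ Has G X d → ¬ Has G X d' →
      RP G col Finset.univ d d' := by
    intro d d' hdd hdd' hX hX'
    obtain ⟨y, hy, h'⟩ := (hdd'.has hd hp).resolve_left hX'
    exact ((((badCY c0 d h0 hdd hX).symm.trans (d4 c0 a0 ha0X h0.1 h0s f0)).trans
      (RP.edge (qy a0 hq0 y hy) (col_xyQ hp ha0X hy hq0))).trans (hcY0 d' y hdd' hy h').symm).mono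
  let A4 : α → Prop := fun c => ∃ a ∈ X, RP G col {4} c a ∧
    ((Bad G v Y c ∧ SingleAt G v c a ∧ ¬ Five c) ∨ ∃ y ∈ Y, RP G col {0, 3} c y)
  let A5 : α → Prop := fun c => Five c ∨ (InC G v c ∧ ¬ Has G X c)
  let T4 : α → Prop := fun c => ∃ a, G.Adj v a ∧ RP G col {4} c a
  let T5 : α → Prop := fun c => ∃ a, G.Adj v a ∧ RP G col {0} c a
  have A4T : ∀ c, A4 c → T4 c := fun c ⟨a, h1, h2, _⟩ => ⟨a, hp.hX a h1, h2⟩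
  have A5T : ∀ c, A5 c → T5 c := by
    rintro c (h | ⟨h, h'⟩)
    · exact ⟨x, hp.hX x hx, five0 c h⟩
    · obtain ⟨y, hy, h'⟩ := (h.has hd hp).resolve_left h'
      exact ⟨y, hp.hY y hy, hcY0 c y h hy h'⟩
  have T45 : ∀ c d, T4 c → T5 d → RP G col Finset.univ c d := fun c d ⟨a, h1, h2⟩ ⟨b, h3, h4⟩ =>
    ((h2.trans (AA a b h1 h3)).trans h4.symm).mono
  have A44n : ∀ c d, A4 c → A4 d → (∃ y ∈ Y, RP G col {0, 3} c y) →
      RP G col Finset.univ c d := by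
    rintro c d _ ⟨a, ha, h1, _⟩ ⟨y, hy, h2⟩
    exact ((h2.trans (xy2 a ha y hy).symm).trans h1.symm).mono
  have A44 : ∀ c d, A4 c → A4 d → RP G col Finset.univ c d := by
    intro c d hc hdd
    obtain ⟨a, ha, h1, h2⟩ := hc
    obtain ⟨b, hb, h3, h4⟩ := hdd
    rcases h2 with h2 | h2
    · rcases h4 with h4 | h4
      · obtain ⟨e, he, h5⟩ := hD c h2.1 ⟨a, h2.2.1⟩ h2.2.2
        exact ((((RP.edge h5 (col_cc2 hp h2.1.1 (hF1 e he).1 h2.1.2.1 (fiveY e he))).trans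
          (five0 e he)).trans (ax d b h4.1 h4.2.1).symm).trans h3.symm).mono
      · exact (A44n d c ⟨b, hb, h3, Or.inr h4⟩ ⟨a, ha, h1, Or.inl h2⟩ h4).symm
    · exact A44n c d ⟨a, ha, h1, Or.inr h2⟩ ⟨b, hb, h3, h4⟩ h2
  have A55 : ∀ c d, A5 c → A5 d → RP G col Finset.univ c d := by
    rintro c d (hc | ⟨hc, hc'⟩) (hdd | ⟨hdd, hdd'⟩)
    · exact ((five0 c hc).trans (fivex d hdd).symm).mono
    · exact fiveCY c d hc hdd hdd'
    · exact (fiveCY d c hdd hc hc').symm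
    · exact CYCY c d hc hdd hc' hdd'
  have cls : ∀ c, InC G v c → (T4 c ∧ T5 c) ∨ A4 c ∨ A5 c := by
    intro c hc
    by_cases hX : Has G X c
    · by_cases hY : Has G Y c
      · left
        obtain ⟨y, hy, h⟩ := hY
        refine ⟨?_, y, hp.hY y hy, hcY0 c y hc hy h⟩
        obtain ⟨a, ha, h'⟩ := hX
        refine ⟨a, hp.hX a ha, RP.edge' h' (col_xc4 hp ha hc ?_)⟩
        rintro ⟨h1 | h1, _⟩
        · exact fiveY c h1 ⟨y, hy, h⟩
        · exact h1.2 ⟨y, hy, h⟩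
      · have memX : ∀ b, G.Adj v b → G.Adj c b → b ∈ X := fun b h1 h2 =>
          (hp.cov b h1).resolve_right fun h => hY ⟨b, h, h2⟩
        by_cases hF : Five c
        · exact Or.inr (Or.inr (Or.inl hF))
        · by_cases hs : Single G v c
          · right; left
            obtain ⟨a, hs⟩ := hs
            have haX := memX a hs.1 hs.2.1
            refine ⟨a, haX, d4 c a haX hc hs hF, ?_⟩
            by_cases hb : Bad G v Y c
            · exact Or.inl ⟨hb, hs, hF⟩
            · right
              have : ∃ c', InC G v c' ∧ G.Adj c c' ∧ Has G Y c' := by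
                by_contra hcon
                exact hb ⟨hc, hY, fun c' a b d => hcon ⟨c', a, b, d⟩⟩
              obtain ⟨c', h1, h2, y, hy, h3⟩ := this
              exact ⟨y, hy, ((RP.edge h2 (col_cc3 hp hc h1 ⟨y, hy, h3⟩)).trans
                (hcY0 c' y h1 hy h3)).mono⟩
          · left
            obtain ⟨h1, h2, _⟩ := hch c hc
            have hcX := memX _ h1 h2
            refine ⟨?_, ch c, h1, RP.edge' h2 (col_xc0 hp hcX hc ⟨Or.inr ⟨hs, hY⟩, rfl⟩)⟩
            by_contra hcon
            refine hs ⟨ch c, h1, h2, fun b h3 h4 => ?_⟩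
            by_contra hb
            exact hcon ⟨b, h3, RP.edge' h4 (col_xc4 hp (memX b h3 h4) hc fun hf => hb hf.2)⟩
    · exact Or.inr (Or.inr (Or.inr ⟨hc, hX⟩))
  have T4or5 : ∀ c, InC G v c → T4 c ∨ T5 c := by
    intro c hc
    rcases cls c hc with h | h | h
    · exact Or.inl h.1
    · exact Or.inl (A4T c h)
    · exact Or.inr (A5T c h)
  have CC : ∀ c d, InC G v c → InC G v d → RP G col Finset.univ c d := by
    intro c d hc hdd
    rcases cls c hc with h | h | h
    · rcases T4or5 d hdd with h' | h'
      · exact (T45 d c h' h.2).symm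
      · exact T45 c d h.1 h'
    · rcases cls d hdd with h' | h' | h'
      · exact T45 c d (A4T c h) h'.2
      · exact A44 c d h h'
      · exact T45 c d (A4T c h) (A5T d h')
    · rcases cls d hdd with h' | h' | h'
      · exact (T45 d c h'.1 (A5T c h)).symm
      · exact (T45 d c (A4T d h') (A5T c h)).symm
      · exact A55 c d h h'
  have CA : ∀ c a, InC G v c → G.Adj v a → RP G col Finset.univ c a := by
    intro c a hc ha
    rcases T4or5 c hc with ⟨b, h1, h2⟩ | ⟨b, h1, h2⟩
    · exact (h2.trans (AA b a h1 ha)).mono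
    · exact (h2.trans (AA b a h1 ha)).mono
  have Cv : ∀ c, InC G v c → RP G col Finset.univ c v := by
    intro c hc
    rcases T4or5 c hc with ⟨b, h1, h2⟩ | ⟨b, h1, h2⟩
    · exact (h2.trans (Av b h1)).mono
    · exact (h2.trans (Av b h1)).mono
  have cs : ∀ u, u = v ∨ G.Adj v u ∨ InC G v u := by
    intro u
    by_cases h : u = v
    · exact Or.inl h
    · by_cases h' : G.Adj v u
      · exact Or.inr (Or.inl h')
      · exact Or.inr (Or.inr ⟨h, h'⟩)
  refine ⟨col, fun u w _ => RP.path (S := Finset.univ) ?_⟩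
  rcases cs u with hu | hu | hu <;> rcases cs w with hw | hw | hw
  · rw [hu, hw]; exact RP.nil
  · rw [hu]; exact (Av w hw).symm.mono
  · rw [hu]; exact (Cv w hw).symm
  · rw [hw]; exact (Av u hu).mono
  · exact (AA u w hu hw).mono
  · exact (CA w u hw hu).symm
  · rw [hw]; exact Cv u hu
  · exact CA u w hu hw
  · exact CC u w hu hw

end stuck

section main
variable {α : Type*} {G : SimpleGraph α} {v : α} {X Y : Set α}

theorem Parti.move (hp : Parti G v X Y) {x : α} (hx : x ∈ X) : Parti G v (X \ {x}) (insert x Y) := by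
  refine ⟨fun a ha => hp.hX a ha.1, ?_, ?_, ?_⟩
  · rintro a (rfl | ha)
    · exact hp.hX _ hx
    · exact hp.hY a ha
  · intro a ha
    by_cases h : a = x
    · exact Or.inr (Or.inl h)
    · rcases hp.cov a ha with h' | h'
      · exact Or.inl ⟨h', h⟩
      · exact Or.inr (Or.inr h')
  · rintro a ⟨h1, h2⟩ (h3 | h3)
    · exact h2 h3
    · exact hp.dis a h1 h3

theorem stuck (hd : D2 G) (hp : Parti G v X Y) {x c0 a0 c1 a1 : α} (hx : x ∈ X)
    (hxn : ∃ b, G.Adj v b ∧ G.Adj x b)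
    (hXY : ∀ a ∈ X, (∃ b, G.Adj v b ∧ G.Adj a b) → ∃ y ∈ Y, G.Adj a y)
    (h0 : Bad G v Y c0) (h0s : SingleAt G v c0 a0) (h0x : a0 ≠ x)
    (h1 : Bad G v (X \ {x}) c1) (h1s : SingleAt G v c1 a1)
    (hR0 : ∀ c a, InC G v c → SingleAt G v c a →
      ∃ c', InC G v c' ∧ G.Adj c c' ∧ ∃ b, G.Adj v b ∧ b ≠ a ∧ G.Adj c' b) :
    ∃ col : Sym2 α → Fin 5, RainbowConnected G col := by
  have hp2 := (hp.move hx).symm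
  have ha1 : a1 ∈ insert x Y := h1.memX hp2 h1s.1 h1s.2.1
  have hcomp : ∀ a ∈ X, a ≠ x → G.Adj a1 a := fun a ha hne => h1.complete hd hp2 h1s ⟨ha, hne⟩
  have hXY' : ∀ a ∈ X, ∃ y ∈ Y, G.Adj a y := by
    intro a ha
    by_cases h : a = x
    · subst h; exact hXY a ha hxn
    · exact hXY a ha ⟨a1, h1s.1, (hcomp a ha h).symm⟩
  have ha0 : a0 ∈ X := h0.memX hp h0s.1 h0s.2.1
  have hYX : ∀ y ∈ Y, ∃ a ∈ X, G.Adj y a := fun y hy => ⟨a0, ha0, (h0.complete hd hp h0s hy).symm⟩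
  have key : ∀ c a, Bad G v Y c → SingleAt G v c a → (a ≠ x ∨ a1 ∈ Y) →
      ∃ w, InC G v w ∧ SingleAt G v w x ∧ G.Adj w c ∧ G.Adj w c1 := by
    intro c a hc hs hor
    have ha : a ∈ X := hc.memX hp hs.1 hs.2.1
    have hne : c ≠ c1 := by
      rintro rfl
      rcases hor with h | h
      · exact h1.2.1 ⟨a, ⟨ha, h⟩, hs.2.1⟩
      · exact hc.2.1 ⟨a1, h, h1s.2.1⟩
    have hna : ¬ G.Adj c c1 := by
      intro hadj
      rcases hor with h | h
      · exact h1.2.2 c hc.1 hadj.symm ⟨a, ⟨ha, h⟩, hs.2.1⟩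
      · exact hc.2.2 c1 h1.1 hadj ⟨a1, h, h1s.2.1⟩
    obtain ⟨w, hw1, hw2⟩ := (hd c c1 hne).resolve_left hna
    have hwC : InC G v w := by
      constructor
      · rintro rfl; exact hc.1.2 hw1.symm
      · intro hv
        have e1 := hs.2.2 w hv hw1
        have e2 := h1s.2.2 w hv hw2.symm
        subst e1
        subst e2
        rcases hor with h | h
        · rcases ha1 with h' | h'
          · exact h h'
          · exact hp.dis _ ha h'
        · exact hp.dis _ ha h
    have hb : ∀ b, G.Adj v b → G.Adj w b → b = x := by
      intro b hvb hwb
      rcases hp.cov b hvb with h | h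
      · by_contra hbx
        exact h1.2.2 w hwC hw2.symm ⟨b, ⟨h, hbx⟩, hwb⟩
      · exact absurd ⟨b, h, hwb⟩ (hc.2.2 w hwC hw1)
    have hwx : G.Adj w x := by
      rcases hwC.has hd hp with ⟨b, h, hwb⟩ | ⟨b, h, hwb⟩
      · rw [hb b (hp.hX b h) hwb] at hwb; exact hwb
      · rw [hb b (hp.hY b h) hwb] at hwb; exact hwb
    exact ⟨w, hwC, ⟨hp.hX x hx, hwx, hb⟩, hw1.symm, hw2⟩
  by_cases hcase : a1 ∈ Y
  · refine core hd hp hx (fun e => InC G v e ∧ SingleAt G v e x ∧ ¬ Bad G v Y e ∧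
      ∃ c, Bad G v Y c ∧ Single G v c ∧ G.Adj e c) hXY' hYX h0 h0s h0x ?_ ?_ ?_ ?_
    · exact fun e he => ⟨he.1, he.2.1⟩
    · rintro c hc ⟨a, hs⟩ -
      obtain ⟨w, hw, hwx, hwc, hw1⟩ := key c a hc hs (Or.inr hcase)
      exact ⟨w, ⟨hw, hwx, fun hb => hb.2.2 c1 h1.1 hw1 ⟨a1, hcase, h1s.2.1⟩, c, hc, ⟨a, hs⟩, hwc⟩,
        hwc.symm⟩
    · rintro e ⟨-, -, -, c, hc, hs, hec⟩
      exact Or.inl ⟨c, hc, hs, fun h => h.2.2.1 hc, hec⟩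
    · exact fun c hc hs => hR0 c x hc.1 hs
  · have e1 : a1 = x := ha1.resolve_right hcase
    subst e1
    refine core hd hp hx (fun e => InC G v e ∧ SingleAt G v e a1 ∧
      ((∃ c a, Bad G v Y c ∧ SingleAt G v c a ∧ a ≠ a1 ∧ G.Adj e c) ∨ Bad G v Y e))
      hXY' hYX h0 h0s h0x ?_ ?_ ?_ ?_
    · exact fun e he => ⟨he.1, he.2.1⟩
    · rintro c hc ⟨a, hs⟩ hF
      have hax : a ≠ a1 := by
        rintro rfl
        exact hF ⟨hc.1, hs, Or.inr hc⟩
      obtain ⟨w, hw, hwx, hwc, hw1⟩ := key c a hc hs (Or.inl hax)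
      exact ⟨w, ⟨hw, hwx, Or.inl ⟨c, a, hc, hs, hax, hwc⟩⟩, hwc.symm⟩
    · rintro e ⟨-, -, ⟨c, a, hc, hs, hax, hec⟩ | hb⟩
      · refine Or.inl ⟨c, hc, ⟨a, hs⟩, fun h => hax ?_, hec⟩
        exact (hs.2.2 _ h.2.1.1 h.2.1.2.1).symm
      · exact Or.inr ⟨hb, hcomp⟩
    · exact fun c hc hs => hR0 c a1 hc.1 hs

end main

section final
variable {α : Type*} {G : SimpleGraph α} {v : α} {X Y : Set α}

/-- `a` is an isolated vertex of the graph induced on `N(v)`. -/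
def Iso (G : SimpleGraph α) (v a : α) : Prop := G.Adj v a ∧ ∀ b, G.Adj v b → ¬ G.Adj a b

theorem Iso.non {a : α} (hv : G.Adj v a) (h : ¬ Iso G v a) : ∃ b, G.Adj v b ∧ G.Adj a b := by
  by_contra hcon
  exact h ⟨hv, fun b h1 h2 => hcon ⟨b, h1, h2⟩⟩

theorem main2 [Finite α] (hd : D2 G)
    (hmax : ∀ a, (G.neighborSet a).ncard ≤ (G.neighborSet v).ncard)
    (hiso : ∀ a, Iso G v a → ∃ c, InC G v c ∧ G.Adj a c)
    (huniq : ∀ a b, Iso G v a → Iso G v b → a = b)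
    (hR0 : ∀ c a, InC G v c → SingleAt G v c a →
      ∃ c', InC G v c' ∧ G.Adj c c' ∧ ∃ b, G.Adj v b ∧ b ≠ a ∧ G.Adj c' b) (n : ℕ) :
    ∀ X Y : Set α, X.ncard = n → Parti G v X Y → Y.Nonempty →
    (∀ a ∈ X, (∃ b, G.Adj v b ∧ G.Adj a b) → ∃ y ∈ Y, G.Adj a y) →
    (∀ y ∈ Y, (∃ a ∈ X, G.Adj y a) ∨ ∃ c, InC G v c ∧ G.Adj y c) →
    (∃ c, Bad G v Y c ∧ Single G v c) →
    ∃ col : Sym2 α → Fin 5, RainbowConnected G col := by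
  induction n with
  | zero =>
    rintro X Y hn hp - - - ⟨c, hc, a, hs⟩
    have ha : a ∈ X := hc.memX hp hs.1 hs.2.1
    rw [(Set.ncard_eq_zero (Set.toFinite X)).mp hn] at ha
    exact absurd ha (Set.notMem_empty a)
  | succ n ih =>
    rintro X Y hn hp hYne hXY hYX ⟨c0, h0, a0, h0s⟩
    have ha0 : a0 ∈ X := h0.memX hp h0s.1 h0s.2.1
    have hcomp : ∀ y ∈ Y, G.Adj a0 y := fun y hy => h0.complete hd hp h0s hy
    by_cases h2 : ∃ x, G.Adj v x ∧ x ≠ a0 ∧ ¬ Iso G v x ∧ ∃ c', InC G v c' ∧ G.Adj c0 c' ∧ G.Adj c' x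
    · obtain ⟨x, hvx, hxa, hxn, c', hc', h0c', hc'x⟩ := h2
      have hx : x ∈ X := (hp.cov x hvx).resolve_right fun h => h0.2.2 c' hc' h0c' ⟨x, h, hc'x⟩
      have ha0' : a0 ∈ X \ {x} := ⟨ha0, fun h => hxa h.symm⟩
      have hp' := hp.move hx
      have hYX' : ∀ y ∈ insert x Y,
          (∃ a ∈ X \ {x}, G.Adj y a) ∨ ∃ c, InC G v c ∧ G.Adj y c := by
        rintro y (rfl | hy)
        · exact Or.inr ⟨c', hc', hc'x.symm⟩
        · exact Or.inl ⟨a0, ha0', (hcomp y hy).symm⟩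
      have hXY' : ∀ a ∈ X \ {x}, (∃ b, G.Adj v b ∧ G.Adj a b) → ∃ y ∈ insert x Y, G.Adj a y := by
        intro a ha hb
        obtain ⟨y, hy, hay⟩ := hXY a ha.1 hb
        exact ⟨y, Or.inr hy, hay⟩
      have hne : (insert x Y).Nonempty := ⟨x, Or.inl rfl⟩
      by_cases hb1 : ∃ c, Bad G v (insert x Y) c ∧ Single G v c
      · refine ih _ _ ?_ hp' hne hXY' hYX' hb1
        have := Set.ncard_sdiff_singleton_add_one hx (Set.toFinite X)
        omega
      · by_cases hb2 : ∃ c, Bad G v (X \ {x}) c ∧ Single G v c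
        · obtain ⟨c1, h1, a1, h1s⟩ := hb2
          exact stuck hd hp hx (Iso.non hvx hxn) hXY h0 h0s hxa.symm h1 h1s hR0
        · refine basic hd hp' ⟨a0, ha0'⟩ hne ?_ hYX' ?_ ?_
          · intro a ha
            by_cases hi : Iso G v a
            · exact Or.inr (hiso a hi)
            · exact Or.inl (hXY' a ha (Iso.non (hp'.hX a ha) hi))
          · exact fun c c' hc _ => absurd ⟨c, hc⟩ hb1
          · exact fun c c' hc _ => absurd ⟨c, hc⟩ hb2
    · obtain ⟨c', hc', h0c', i, hvi, hia, hci⟩ := hR0 c0 a0 h0.1 h0s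
      have hi : Iso G v i := by
        by_contra hcon
        exact h2 ⟨i, hvi, hia, hcon, c', hc', h0c', hci⟩
      have hadj : ∀ a, G.Adj v a → a ≠ a0 → a ≠ i → G.Adj a0 a := by
        intro a hva ha hai
        have hne : c0 ≠ a := by
          rintro rfl
          exact h0.1.2 hva
        rcases hd c0 a hne with h | ⟨m, hm1, hm2⟩
        · exact absurd (h0s.2.2 a hva h) ha
        · by_cases hvm : G.Adj v m
          · rw [h0s.2.2 m hvm hm1] at hm2
            exact hm2
          · exfalso
            have hmC : InC G v m := by
              refine ⟨?_, hvm⟩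
              rintro rfl
              exact h0.1.2 hm1.symm
            refine h2 ⟨a, hva, ha, fun hisoa => hai (huniq a i hisoa hi), m, hmC, hm1, hm2⟩
      have honly : ∀ d, InC G v d → G.Adj a0 d → d = c0 := by
        intro d hdC hdadj
        by_contra hdc
        obtain ⟨T, hT⟩ : ∃ T : Set α, T = (G.neighborSet v \ {a0}) \ {i} := ⟨_, rfl⟩
        have e1 := Set.ncard_sdiff_singleton_add_one (s := G.neighborSet v) h0s.1 (Set.toFinite _)
        have e2 := Set.ncard_sdiff_singleton_add_one (s := G.neighborSet v \ {a0}) (a := i)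
          ⟨hvi, hia⟩ (Set.toFinite _)
        rw [← hT] at e2
        have hTm : ∀ z ∈ T, G.Adj v z ∧ z ≠ a0 ∧ z ≠ i := by
          intro z hz
          rw [hT] at hz
          exact ⟨hz.1.1, hz.1.2, hz.2⟩
        have hdT : d ∉ T := fun h => hdC.2 (hTm _ h).1
        have hcT : c0 ∉ insert d T := by
          rintro (h | h)
          · exact hdc h.symm
          · exact h0.1.2 (hTm _ h).1
        have hvT : v ∉ insert c0 (insert d T) := by
          rintro (h | h | h)
          · exact h0.1.1 h.symm
          · exact hdC.1 h.symm
          · exact G.loopless.irrefl v (hTm _ h).1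
        have e3 := Set.ncard_insert_of_notMem hdT (Set.toFinite _)
        have e4 := Set.ncard_insert_of_notMem hcT (Set.toFinite _)
        have e5 := Set.ncard_insert_of_notMem hvT (Set.toFinite _)
        have hsub : insert v (insert c0 (insert d T)) ⊆ G.neighborSet a0 := by
          rintro z (rfl | rfl | rfl | hz)
          · exact h0s.1.symm
          · exact h0s.2.1.symm
          · exact hdadj
          · exact hadj z (hTm z hz).1 (hTm z hz).2.1 (hTm z hz).2.2
        have e6 := Set.ncard_le_ncard hsub (Set.toFinite _)
        have e7 := hmax a0
        omega
      have hp' : Parti G v {a0, i} {a | G.Adj v a ∧ a ≠ a0 ∧ a ≠ i} := by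
        refine ⟨?_, fun a ha => ha.1, ?_, ?_⟩
        · rintro a (rfl | rfl)
          · exact h0s.1
          · exact hvi
        · intro a ha
          by_cases h1 : a = a0
          · exact Or.inl (Or.inl h1)
          · by_cases h3 : a = i
            · exact Or.inl (Or.inr h3)
            · exact Or.inr ⟨ha, h1, h3⟩
        · rintro a (rfl | rfl) h
          · exact h.2.1 rfl
          · exact h.2.2 rfl
      obtain ⟨y, hy⟩ := hYne
      have hy' : y ∈ {a | G.Adj v a ∧ a ≠ a0 ∧ a ≠ i} := by
        refine ⟨hp.hY y hy, ?_, ?_⟩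
        · rintro rfl
          exact hp.dis _ ha0 hy
        · rintro rfl
          exact hi.2 a0 h0s.1 (hcomp _ hy).symm
      have hBX : ∀ c, Bad G v {a | G.Adj v a ∧ a ≠ a0 ∧ a ≠ i} c ∧ Single G v c → c = c0 := by
        rintro c ⟨hc, a, hs⟩
        have ha := hc.memX hp' hs.1 hs.2.1
        rcases ha with h | h
        · rw [h] at hs
          exact honly c hc.1 hs.2.1.symm
        · rw [h] at hs
          exact absurd (hc.complete hd hp' hs hy') (hi.2 y hy'.1)
      refine basic hd hp' ⟨a0, Or.inl rfl⟩ ⟨y, hy'⟩ ?_ ?_ ?_ ?_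
      · rintro a (rfl | rfl)
        · exact Or.inr ⟨c0, h0.1, h0s.2.1.symm⟩
        · exact Or.inr ⟨c', hc', hci.symm⟩
      · exact fun a ha => Or.inl ⟨a0, Or.inl rfl, (hadj a ha.1 ha.2.1 ha.2.2).symm⟩
      · exact fun c c' hc hc' => (hBX c hc).trans (hBX c' hc').symm
      · rintro c c' ⟨hc, a, hs⟩ -
        exact absurd (hc.complete hd hp'.symm hs (Or.inr rfl)).symm (hi.2 a hs.1)

theorem exists_parti [Finite α] (G : SimpleGraph α) (v : α) : ∃ X Y : Set α, Parti G v X Y ∧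
    (∀ a, Iso G v a → a ∈ X) ∧
    (∀ a ∈ X, (∃ b, G.Adj v b ∧ G.Adj a b) → ∃ y ∈ Y, G.Adj a y) ∧
    (∀ y ∈ Y, ∃ a ∈ X, G.Adj y a) := by
  obtain ⟨S, hS⟩ := (Set.toFinite {S : Set α | (∀ a ∈ S, G.Adj v a) ∧
    ∀ a ∈ S, ∀ b ∈ S, ¬ G.Adj a b}).exists_maximal ⟨∅, by simp⟩
  obtain ⟨⟨hSv, hSi⟩, hSm⟩ := hS
  have ext_mem : ∀ a, G.Adj v a → (∀ b ∈ S, ¬ G.Adj a b) → a ∈ S := by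
    intro a hva hab
    refine hSm (y := insert a S) ⟨?_, ?_⟩ (Set.subset_insert a S) (Or.inl rfl)
    · rintro z (rfl | hz)
      · exact hva
      · exact hSv z hz
    · rintro z (rfl | hz) w (rfl | hw)
      · exact G.loopless.irrefl _
      · exact hab w hw
      · exact fun h => hab z hz h.symm
      · exact hSi z hz w hw
  refine ⟨S, {a | G.Adj v a ∧ a ∉ S}, ⟨hSv, fun a ha => ha.1, ?_, fun a ha h => h.2 ha⟩, ?_, ?_, ?_⟩
  · intro a ha
    by_cases h : a ∈ S
    · exact Or.inl h
    · exact Or.inr ⟨ha, h⟩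
  · exact fun a ha => ext_mem a ha.1 fun b hb => ha.2 b (hSv b hb)
  · rintro a ha ⟨b, hvb, hab⟩
    exact ⟨b, ⟨hvb, fun hb => hSi a ha b hb hab⟩, hab⟩
  · rintro y ⟨hvy, hyS⟩
    by_contra hcon
    exact hyS (ext_mem y hvy fun b hb h => hcon ⟨b, hb, h⟩)

theorem main3 [Finite α] (hd : D2 G)
    (hmax : ∀ a, (G.neighborSet a).ncard ≤ (G.neighborSet v).ncard)
    (hdeg : ∀ u w, G.Adj u w → ∃ w', w' ≠ w ∧ G.Adj u w') (hv : ∃ a, G.Adj v a) :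
    ∃ col : Sym2 α → Fin 5, RainbowConnected G col := by
  have hiso : ∀ a, Iso G v a → ∃ c, InC G v c ∧ G.Adj a c := by
    intro a ha
    obtain ⟨c, hcv, hac⟩ := hdeg a v ha.1.symm
    exact ⟨c, ⟨hcv, fun h => ha.2 c h hac⟩, hac⟩
  have hR0 : ∀ c a, InC G v c → SingleAt G v c a →
      ∃ c', InC G v c' ∧ G.Adj c c' ∧ ∃ b, G.Adj v b ∧ b ≠ a ∧ G.Adj c' b := by
    intro c a hc hs
    by_contra hcon
    have hadj : ∀ b, G.Adj v b → b ≠ a → G.Adj a b := by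
      intro b hvb hba
      have hne : c ≠ b := by
        rintro rfl
        exact hc.2 hvb
      rcases hd c b hne with h | ⟨m, hm1, hm2⟩
      · exact absurd (hs.2.2 b hvb h) hba
      · by_cases hvm : G.Adj v m
        · rw [hs.2.2 m hvm hm1] at hm2
          exact hm2
        · refine absurd ⟨m, ⟨?_, hvm⟩, hm1, b, hvb, hba, hm2⟩ hcon
          rintro rfl
          exact hc.2 hm1.symm
    have e1 := Set.ncard_sdiff_singleton_add_one (s := G.neighborSet v) hs.1 (Set.toFinite _)
    have hcT : c ∉ G.neighborSet v \ {a} := fun h => hc.2 h.1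
    have hvT : v ∉ insert c (G.neighborSet v \ {a}) := by
      rintro (h | h)
      · exact hc.1 h.symm
      · exact G.loopless.irrefl v h.1
    have e4 := Set.ncard_insert_of_notMem hcT (Set.toFinite _)
    have e5 := Set.ncard_insert_of_notMem hvT (Set.toFinite _)
    have hsub : insert v (insert c (G.neighborSet v \ {a})) ⊆ G.neighborSet a := by
      rintro z (rfl | rfl | hz)
      · exact hs.1.symm
      · exact hs.2.1.symm
      · exact hadj z hz.1 hz.2
    have e6 := Set.ncard_le_ncard hsub (Set.toFinite _)
    have e7 := hmax a
    omega
  obtain ⟨X, Y, hp, hI, hXY, hYX⟩ := exists_parti G v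
  by_cases huniq : ∀ a b, Iso G v a → Iso G v b → a = b
  · obtain ⟨a, b, hva, hab⟩ : ∃ a b, G.Adj v a ∧ G.Adj v b ∧ G.Adj a b := by
      obtain ⟨a, hva⟩ := hv
      obtain ⟨b, hba, hvb⟩ := hdeg v a hva
      by_cases h : Iso G v a
      · obtain ⟨z, hz⟩ := Iso.non hvb fun h' => hba (huniq b a h' h)
        exact ⟨b, z, hvb, hz⟩
      · obtain ⟨z, hz⟩ := Iso.non hva h
        exact ⟨a, z, hva, hz⟩
    have hne : X.Nonempty ∧ Y.Nonempty := by
      rcases hp.cov a hva with h | h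
      · obtain ⟨y, hy, -⟩ := hXY a h ⟨b, hab⟩
        exact ⟨⟨a, h⟩, ⟨y, hy⟩⟩
      · obtain ⟨y, hy, -⟩ := hYX a h
        exact ⟨⟨y, hy⟩, ⟨a, h⟩⟩
    have hadX : ∀ a ∈ X, (∃ y ∈ Y, G.Adj a y) ∨ ∃ c, InC G v c ∧ G.Adj a c := by
      intro a ha
      by_cases hi : Iso G v a
      · exact Or.inr (hiso a hi)
      · exact Or.inl (hXY a ha (Iso.non (hp.hX a ha) hi))
    by_cases hb1 : ∃ c, Bad G v Y c ∧ Single G v c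
    · exact main2 hd hmax hiso huniq hR0 _ X Y rfl hp hne.2 hXY (fun y hy => Or.inl (hYX y hy)) hb1
    · by_cases hb2 : ∃ c, Bad G v X c ∧ Single G v c
      · exact main2 hd hmax hiso huniq hR0 _ Y X rfl hp.symm hne.1 (fun y hy _ => hYX y hy) hadX hb2
      · refine basic hd hp hne.1 hne.2 hadX (fun y hy => Or.inl (hYX y hy)) ?_ ?_
        · exact fun c c' hc _ => absurd ⟨c, hc⟩ hb1
        · exact fun c c' hc _ => absurd ⟨c, hc⟩ hb2
  · push Not at huniq
    obtain ⟨i1, i2, h1, h2, hne⟩ := huniq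
    have hp' := hp.move (hI i1 h1)
    have hi2 : i2 ∈ X \ {i1} := ⟨hI i2 h2, fun h => hne h.symm⟩
    refine basic hd hp' ⟨i2, hi2⟩ ⟨i1, Or.inl rfl⟩ ?_ ?_ ?_ ?_
    · intro a ha
      by_cases hi : Iso G v a
      · exact Or.inr (hiso a hi)
      · obtain ⟨y, hy, hay⟩ := hXY a ha.1 (Iso.non (hp'.hX a ha) hi)
        exact Or.inl ⟨y, Or.inr hy, hay⟩
    · rintro a (rfl | ha)
      · exact Or.inr (hiso _ h1)
      · obtain ⟨y, hy, hay⟩ := hYX a ha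
        refine Or.inl ⟨y, ⟨hy, ?_⟩, hay⟩
        rintro rfl
        exact h1.2 a (hp.hY a ha) hay.symm
    · rintro c c' ⟨hc, a, hs⟩ -
      exact absurd (hc.complete hd hp' hs (Or.inl rfl)).symm (h1.2 a hs.1)
    · rintro c c' ⟨hc, a, hs⟩ -
      exact absurd (hc.complete hd hp'.symm hs hi2).symm (h2.2 a hs.1)

end final

end RC

/-- If `G` is a connected bridgeless finite simple graph with diameter 2, then `rc(G) ≤ 5`:
there is an edge coloring with at most 5 colors making `G` rainbow connected. -/
theorem rc_le_five_of_diam_two {α : Type*} [Fintype α] (G : SimpleGraph α)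
    (hconn : G.Connected) (hbridgeless : ∀ e : Sym2 α, ¬ G.IsBridge e)
    (hdiam : G.diam = 2) :
    ∃ c : Sym2 α → Fin 5, RainbowConnected G c := by
  have hd : RC.D2 G := by
    intro u w huw
    have htop : G.ediam ≠ ⊤ := SimpleGraph.ediam_ne_top_of_diam_ne_zero (by omega)
    have hle : G.dist u w ≤ 2 := hdiam ▸ SimpleGraph.dist_le_diam htop
    obtain ⟨p, hlen⟩ := hconn.exists_walk_length_eq_dist u w
    rw [← hlen] at hle
    cases p with
    | nil => exact absurd rfl huw
    | cons h q =>
      cases q with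
      | nil => exact Or.inl h
      | cons h' r =>
        cases r with
        | nil => exact Or.inr ⟨_, h, h'⟩
        | cons h'' s =>
          simp only [SimpleGraph.Walk.length_cons] at hle
          omega
  have hdeg : ∀ u w, G.Adj u w → ∃ w', w' ≠ w ∧ G.Adj u w' := by
    intro u w huw
    have hb := hbridgeless s(u, w)
    rw [SimpleGraph.isBridge_iff, not_not] at hb
    obtain ⟨p⟩ := hb
    cases p with
    | nil => exact absurd huw (G.loopless.irrefl _)
    | cons h q =>
      rw [SimpleGraph.deleteEdges_adj] at h
      refine ⟨_, ?_, h.1⟩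
      rintro rfl
      exact h.2 rfl
  have := hconn.nonempty
  obtain ⟨v, hmax⟩ := Finite.exists_max fun a => (G.neighborSet a).ncard
  have hv : ∃ a, G.Adj v a := by
    by_contra hcon
    have hnt : ∀ w, w = v := by
      intro w
      by_contra hne
      rcases hd v w (Ne.symm hne) with h | ⟨m, h, -⟩
      · exact hcon ⟨w, h⟩
      · exact hcon ⟨m, h⟩
    have : Subsingleton α := ⟨fun a b => (hnt a).trans (hnt b).symm⟩
    have h0 : G.diam = 0 := SimpleGraph.diam_eq_zero.mpr (Or.inr this)
    omega
  exact RC.main3 hd hmax hdeg hv
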